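/- arXiv:1112.2351 — 2 statements merged into one kernel-verified Lean document; each statement's English description precedes it below -/
import Mathlib

section
/- Let p, r : [0,1] → ℝ be continuous with p(x) > 0 and r(x) > 0 for all x ∈ [0,1], and let c, α ∈ ℝ. Suppose λ ∈ Λ(p). Then (i) any two classical solutions of (p·y'')'' − λ·(−y'' + c·r·y) = 0 satisfying y(0) = y'(0) = y(1) = y'(1) = 0 are linearly dependent, and (ii) any two classical solutions of the same equation satisfying y(0) = y'(0) = y'(1) = 0 and (p·y'')'(1) + λ·α·y(1) = 0 are linearly dependent; i.e., every eigenvalue of either boundary-value problem belonging to Λ(p) has geometric multiplicity 1. -/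
open Set

/-- Derivative within the interval `[0,1]`. -/
noncomputable def Dv (y : ℝ → ℝ) : ℝ → ℝ := derivWithin y (Set.Icc 0 1)

/-- `y` is not identically zero on `[0,1]`. -/
def Nontriv (y : ℝ → ℝ) : Prop := ∃ x ∈ Set.Icc (0:ℝ) 1, y x ≠ 0

/-- `y` is a classical solution of `(p y'')'' - lam * (-y'' + c r y) = 0` on `[0,1]`. -/
def SolT (p r : ℝ → ℝ) (c lam : ℝ) (y : ℝ → ℝ) : Prop :=
  ContDiffOn ℝ 2 y (Set.Icc 0 1) ∧
  ContDiffOn ℝ 2 (fun x => p x * Dv (Dv y) x) (Set.Icc 0 1) ∧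
  ∀ x ∈ Set.Icc (0:ℝ) 1,
    Dv (Dv (fun t => p t * Dv (Dv y) t)) x
      - lam * (-(Dv (Dv y) x) + c * r x * y x) = 0

/-- Clamped boundary conditions `y(0) = y'(0) = y(1) = y'(1) = 0`. -/
def BC1 (y : ℝ → ℝ) : Prop := y 0 = 0 ∧ Dv y 0 = 0 ∧ y 1 = 0 ∧ Dv y 1 = 0

/-- Boundary conditions `y(0) = y'(0) = y'(1) = 0`, `(p y'')'(1) + lam * alpha * y(1) = 0`. -/
def BC2 (p : ℝ → ℝ) (lam alpha : ℝ) (y : ℝ → ℝ) : Prop :=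
  y 0 = 0 ∧ Dv y 0 = 0 ∧ Dv y 1 = 0 ∧
  Dv (fun t => p t * Dv (Dv y) t) 1 + lam * alpha * y 1 = 0

/-- Linear dependence of two functions on `[0,1]`. -/
def LinDep (y₁ y₂ : ℝ → ℝ) : Prop :=
  ∃ a b : ℝ, (a ≠ 0 ∨ b ≠ 0) ∧ ∀ x ∈ Set.Icc (0:ℝ) 1, a * y₁ x + b * y₂ x = 0

/-- `μ` is a Dirichlet eigenvalue of the Sturm–Liouville problem
`-(p w')' = μ w`, `w(0) = w(1) = 0` on `[0,1]`. -/
def DirichletEig (p : ℝ → ℝ) (μ : ℝ) : Prop :=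
  ∃ w : ℝ → ℝ, ContDiffOn ℝ 1 w (Set.Icc 0 1) ∧
    ContDiffOn ℝ 1 (fun x => p x * Dv w x) (Set.Icc 0 1) ∧
    (∀ x ∈ Set.Icc (0:ℝ) 1, -(Dv (fun t => p t * Dv w t) x) = μ * w x) ∧
    Nontriv w ∧ w 0 = 0 ∧ w 1 = 0

/-- The admissible set `Λ(p)`: all `lam` lying strictly below every Dirichlet
eigenvalue of `-(p w')'` on `[0,1]`. -/
def AdmSet (p : ℝ → ℝ) : Set ℝ := {lam : ℝ | ∀ μ : ℝ, DirichletEig p μ → lam < μ}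


lemma toIci {f : ℝ → ℝ} {f' t : ℝ} (h : HasDerivWithinAt f f' (Icc 0 1) t) (ht : t ∈ Ico (0:ℝ) 1) :
    HasDerivWithinAt f f' (Ici t) t :=
  h.mono_of_mem_nhdsWithin (Icc_mem_nhdsGE_of_mem ht)

lemma exists_antideriv (g : ℝ → ℝ) (hg : ContinuousOn g (Icc 0 1)) :
    ∃ G : ℝ → ℝ, ∀ t ∈ Icc (0:ℝ) 1, HasDerivWithinAt G (g t) (Icc 0 1) t := by
  have hc : Continuous (IccExtend (zero_le_one' ℝ) ((Icc (0:ℝ) 1).domRestrict g)) :=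
    (continuousOn_iff_continuous_domRestrict.1 hg).Icc_extend'
  refine ⟨fun u => ∫ x in (0:ℝ)..u, IccExtend (zero_le_one' ℝ) ((Icc (0:ℝ) 1).domRestrict g) x, ?_⟩
  intro t ht
  have := (hc.integral_hasStrictDerivAt 0 t).hasDerivAt.hasDerivWithinAt (s := Icc 0 1)
  rwa [IccExtend_of_mem _ _ ht] at this

/-- Pruefer vector field. -/
noncomputable def prF (Q : ℝ → ℝ) (μ t x : ℝ) : ℝ :=
  Q t * Real.cos x ^ 2 + μ * Real.sin x ^ 2

lemma prF_lip (Q : ℝ → ℝ) (C : ℝ) (hQ : ∀ t, 0 < Q t) (hC : ∀ t, Q t ≤ C) (μ t : ℝ) :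
    LipschitzWith (Real.toNNReal (2 * (C + |μ|))) (prF Q μ t) := by
  have hC0 : 0 < C := (hQ 0).trans_le (hC 0)
  apply LipschitzWith.of_dist_le_mul
  intro x y
  rw [Real.coe_toNNReal _ (by positivity), Real.dist_eq, Real.dist_eq]
  have e : prF Q μ t x - prF Q μ t y
      = (Q t - μ) * ((Real.cos x - Real.cos y) * (Real.cos x + Real.cos y)) := by
    unfold prF
    rw [Real.sin_sq, Real.sin_sq]; ring
  rw [e, abs_mul, abs_mul]
  have h1 : |Q t - μ| ≤ C + |μ| := by
    calc |Q t - μ| ≤ |Q t| + |μ| := abs_sub _ _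
      _ ≤ C + |μ| := by rw [abs_of_pos (hQ t)]; linarith [hC t]
  have h2 := Real.abs_cos_sub_cos_le x y
  have h3 : |Real.cos x + Real.cos y| ≤ 2 := by
    calc _ ≤ |Real.cos x| + |Real.cos y| := abs_add_le _ _
      _ ≤ 2 := by linarith [Real.abs_cos_le_one x, Real.abs_cos_le_one y]
  calc _ ≤ (C + |μ|) * (|x - y| * 2) := by gcongr
    _ = _ := by ring

lemma prF_bound (Q : ℝ → ℝ) (C : ℝ) (hQ : ∀ t, 0 < Q t) (hC : ∀ t, Q t ≤ C) (μ t x : ℝ) :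
    |prF Q μ t x| ≤ C + |μ| := by
  have hC0 : 0 < C := (hQ 0).trans_le (hC 0)
  unfold prF
  calc _ ≤ |Q t * Real.cos x ^ 2| + |μ * Real.sin x ^ 2| := abs_add_le _ _
    _ = Q t * Real.cos x ^ 2 + |μ| * Real.sin x ^ 2 := by
      rw [abs_mul, abs_mul, abs_of_pos (hQ t), abs_sq, abs_sq]
    _ ≤ C * 1 + |μ| * 1 := by
      gcongr
      · exact hC t
      · exact Real.cos_sq_le_one x
      · exact Real.sin_sq_le_one x
    _ = _ := by ring

def IsPr (Q : ℝ → ℝ) (μ a : ℝ) (θ : ℝ → ℝ) : Prop :=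
  θ 0 = a ∧ ∀ t ∈ Icc (0:ℝ) 1, HasDerivWithinAt θ (prF Q μ t (θ t)) (Icc 0 1) t

lemma IsPr.cont {Q : ℝ → ℝ} {μ a : ℝ} {θ : ℝ → ℝ} (h : IsPr Q μ a θ) :
    ContinuousOn θ (Icc 0 1) := fun t ht => (h.2 t ht).continuousWithinAt

lemma exists_pr (Q : ℝ → ℝ) (C : ℝ) (hQc : Continuous Q) (hQ : ∀ t, 0 < Q t) (hC : ∀ t, Q t ≤ C)
    (μ a : ℝ) : ∃ θ, IsPr Q μ a θ := by
  have hC0 : 0 < C := (hQ 0).trans_le (hC 0)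
  have hb : 0 ≤ C + |μ| := by positivity
  have H : IsPicardLindelof (prF Q μ) (tmin := 0) (tmax := 1) ⟨0, by simp⟩ a
      (Real.toNNReal (C + |μ|)) 0 (Real.toNNReal (C + |μ|)) (Real.toNNReal (2 * (C + |μ|))) := by
    refine ⟨fun t _ => (prF_lip Q C hQ hC μ t).lipschitzOnWith, ?_, ?_, ?_⟩
    · intro x _
      unfold prF
      fun_prop
    · intro t _ x _
      rw [Real.coe_toNNReal _ hb]
      exact prF_bound Q C hQ hC μ t x
    · simp
  obtain ⟨θ, h0, h1⟩ := H.exists_eq_forall_mem_Icc_hasDerivWithinAt₀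
  exact ⟨θ, h0, h1⟩

lemma pr_dist {Q : ℝ → ℝ} {C : ℝ} (hQ : ∀ t, 0 < Q t) (hC : ∀ t, Q t ≤ C)
    {μ ν a b : ℝ} {θ φ : ℝ → ℝ} (h1 : IsPr Q μ a θ) (h2 : IsPr Q ν b φ) :
    |θ 1 - φ 1| ≤ gronwallBound |a - b| (2 * (C + |μ|)) |ν - μ| 1 := by
  have hC0 : 0 < C := (hQ 0).trans_le (hC 0)
  have := dist_le_of_approx_trajectories_ODE (v := prF Q μ) (K := Real.toNNReal (2 * (C + |μ|)))
    (fun t => prF_lip Q C hQ hC μ t)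
    (f := θ) (g := φ) (f' := fun t => prF Q μ t (θ t)) (g' := fun t => prF Q ν t (φ t))
    (a := 0) (b := 1) (εf := 0) (εg := |ν - μ|) (δ := |a - b|)
    h1.cont (fun t ht => toIci (h1.2 t (Ico_subset_Icc_self ht)) ht) (fun t _ => by simp)
    h2.cont (fun t ht => toIci (h2.2 t (Ico_subset_Icc_self ht)) ht)
    (fun t _ => by
      rw [Real.dist_eq]
      have e : prF Q ν t (φ t) - prF Q μ t (φ t) = (ν - μ) * Real.sin (φ t) ^ 2 := by
        unfold prF; ring
      rw [e, abs_mul, abs_sq]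
      have := Real.sin_sq_le_one (φ t)
      nlinarith [abs_nonneg (ν - μ)])
    (by rw [h1.1, h2.1, Real.dist_eq]) 1 (by simp)
  rw [Real.coe_toNNReal _ (by positivity), Real.dist_eq] at this
  simpa using this

/-- Never crosses down a level at which the derivative is positive. -/
lemma pr_fence {Q : ℝ → ℝ} (hQ : ∀ t, 0 < Q t) {μ a : ℝ} {θ : ℝ → ℝ} (h : IsPr Q μ a θ)
    {c : ℝ} (hc : Real.sin c = 0) {s : ℝ} (hs : s ∈ Icc (0:ℝ) 1) (hsc : c ≤ θ s) :
    ∀ t ∈ Icc s 1, c ≤ θ t := by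
  have hsub : Icc s 1 ⊆ Icc 0 1 := Icc_subset_Icc_left hs.1
  refine image_le_of_deriv_right_lt_deriv_boundary' (f := fun _ => c) (f' := fun _ => 0)
    continuousOn_const (fun x _ => hasDerivWithinAt_const _ _ _) hsc (h.cont.mono hsub)
    (B' := fun t => prF Q μ t (θ t))
    (fun t ht => toIci (h.2 t (hsub (Ico_subset_Icc_self ht))) ⟨hs.1.trans ht.1, ht.2⟩) ?_
  intro x _ e
  have e' : θ x = c := e.symm
  have : Real.cos c ^ 2 = 1 := by rw [Real.cos_sq', hc]; ring
  simp only [prF, e', this, hc]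
  have := hQ x
  simpa using this

lemma pr_pos {Q : ℝ → ℝ} (hQ : ∀ t, 0 < Q t) {μ a : ℝ} {θ : ℝ → ℝ} (h : IsPr Q μ a θ)
    (ha : 0 ≤ a) {t : ℝ} (ht : t ∈ Ioc (0:ℝ) 1) : 0 < θ t := by
  have hge := pr_fence hQ h Real.sin_zero (s := 0) (by simp) (by rw [h.1]; exact ha)
  have ht' := Ioc_subset_Icc_self ht
  refine lt_of_le_of_ne (hge t ht') ?_
  intro h0
  have hd := h.2 t ht'
  have hmin : IsMinOn θ (Icc 0 1) t := fun x hx => by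
    show θ t ≤ θ x
    rw [← h0]; exact hge x hx
  have e : prF Q μ t (θ t) = Q t := by simp [prF, ← h0]
  rw [e] at hd
  have hp := hmin.localize.hasFDerivWithinAt_nonneg hd.hasFDerivWithinAt (y := (0 - t))
    (sub_mem_posTangentConeAt_of_segment_subset ((convex_Icc 0 1).segment_subset ht' (by simp)))
  simp at hp
  have := hQ t
  nlinarith [ht.1]

lemma pr_neg {Q : ℝ → ℝ} {μ : ℝ} (hμ : μ < 0) {θ : ℝ → ℝ} (h : IsPr Q μ 0 θ) :
    θ 1 < Real.pi := by
  have : θ 1 ≤ Real.pi / 2 := by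
    refine image_le_of_deriv_right_lt_deriv_boundary' (f := θ) (f' := fun t => prF Q μ t (θ t))
      (B := fun _ => Real.pi / 2) (B' := fun _ => 0) (a := 0) (b := 1)
      h.cont (fun t ht => toIci (h.2 t (Ico_subset_Icc_self ht)) ht) ?_
      continuousOn_const (fun x _ => hasDerivWithinAt_const _ _ _) ?_ (by simp)
    · rw [h.1]; positivity
    · intro x _ e
      simpa [prF, e] using hμ
  linarith [Real.pi_pos]

lemma pr_sol {Q : ℝ → ℝ} (hQc : Continuous Q) {μ a : ℝ} {θ : ℝ → ℝ} (h : IsPr Q μ a θ) :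
    ∃ w q R : ℝ → ℝ, (∀ t, 0 < R t) ∧ (∀ t, w t = R t * Real.sin (θ t)) ∧
      ∀ t ∈ Icc (0:ℝ) 1, HasDerivWithinAt w (Q t * q t) (Icc 0 1) t ∧
        HasDerivWithinAt q (-μ * w t) (Icc 0 1) t := by
  obtain ⟨G, hG⟩ := exists_antideriv
    (fun t => (Q t - μ) * (Real.sin (θ t) * Real.cos (θ t))) (by
      have := h.cont
      fun_prop)
  refine ⟨fun t => Real.exp (G t) * Real.sin (θ t), fun t => Real.exp (G t) * Real.cos (θ t),
    fun t => Real.exp (G t), fun t => Real.exp_pos _, fun _ => rfl, ?_⟩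
  intro t ht
  have h1 := hG t ht
  have h2 := h.2 t ht
  have hs := Real.sin_sq_add_cos_sq (θ t)
  constructor
  · refine (h1.exp.mul h2.sin).congr_deriv ?_
    unfold prF
    linear_combination ((Q t * Real.cos (θ t) * Real.exp (G t))) * hs
  · refine (h1.exp.mul h2.cos).congr_deriv ?_
    unfold prF
    linear_combination (-(μ * Real.sin (θ t) * Real.exp (G t))) * hs

lemma uniq01 {t : ℝ} (ht : t ∈ Icc (0:ℝ) 1) : UniqueDiffWithinAt ℝ (Icc (0:ℝ) 1) t :=
  (uniqueDiffOn_Icc zero_lt_one) t ht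

lemma Dv_eq {f : ℝ → ℝ} {f' t : ℝ} (ht : t ∈ Icc (0:ℝ) 1)
    (h : HasDerivWithinAt f f' (Icc 0 1) t) : Dv f t = f' := h.derivWithin (uniq01 ht)

lemma cd_one {f f' : ℝ → ℝ} (h : ∀ t ∈ Icc (0:ℝ) 1, HasDerivWithinAt f (f' t) (Icc 0 1) t)
    (hc : ContinuousOn f' (Icc 0 1)) : ContDiffOn ℝ 1 f (Icc 0 1) := by
  rw [contDiffOn_one_iff_derivWithin (uniqueDiffOn_Icc zero_lt_one)]
  refine ⟨fun t ht => (h t ht).differentiableWithinAt, hc.congr ?_⟩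
  intro t ht
  exact (h t ht).derivWithin (uniq01 ht)

lemma exists_pos_sol (p : ℝ → ℝ) (lam : ℝ) (hpc : ContinuousOn p (Icc 0 1))
    (hp : ∀ x ∈ Icc (0:ℝ) 1, 0 < p x) (hlam : lam ∈ AdmSet p) :
    ∃ h q : ℝ → ℝ, ∀ t ∈ Icc (0:ℝ) 1, 0 < h t ∧ HasDerivWithinAt h (q t / p t) (Icc 0 1) t ∧
      HasDerivWithinAt q (-lam * h t) (Icc 0 1) t := by
  have hic : ContinuousOn (fun t => (p t)⁻¹) (Icc 0 1) := hpc.inv₀ (fun t ht => (hp t ht).ne')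
  obtain ⟨Q, hQdef⟩ : ∃ Q : ℝ → ℝ,
    Q = IccExtend (zero_le_one' ℝ) ((Icc (0:ℝ) 1).domRestrict (fun t => (p t)⁻¹)) := ⟨_, rfl⟩
  have hQc : Continuous Q := by
    rw [hQdef]; exact (continuousOn_iff_continuous_domRestrict.1 hic).Icc_extend'
  have hQe : ∀ t ∈ Icc (0:ℝ) 1, Q t = (p t)⁻¹ := by
    intro t ht; rw [hQdef, IccExtend_of_mem _ _ ht]; rfl
  have hQm : ∀ t, ∃ s ∈ Icc (0:ℝ) 1, Q t = (p s)⁻¹ := by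
    intro t
    refine ⟨projIcc 0 1 zero_le_one t, (projIcc 0 1 zero_le_one t).2, ?_⟩
    rw [hQdef]; rfl
  have hQ : ∀ t, 0 < Q t := by
    intro t; obtain ⟨s, hs, e⟩ := hQm t
    rw [e]; exact inv_pos.2 (hp s hs)
  obtain ⟨C, hC⟩ : ∃ C, ∀ t, Q t ≤ C := by
    obtain ⟨C, hC⟩ := isCompact_Icc.bddAbove_image hic
    refine ⟨C, fun t => ?_⟩
    obtain ⟨s, hs, e⟩ := hQm t
    rw [e]; exact hC ⟨s, hs, rfl⟩
  choose θ hθ using fun μ => exists_pr Q C hQc hQ hC μ 0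
  have hcont : Continuous (fun μ => θ μ 1) := by
    rw [continuous_iff_continuousAt]
    intro μ
    rw [ContinuousAt, tendsto_iff_dist_tendsto_zero]
    have hb : ∀ ν, dist (θ ν 1) (θ μ 1) ≤ gronwallBound 0 (2 * (C + |μ|)) |ν - μ| 1 := by
      intro ν
      rw [dist_comm, Real.dist_eq]
      simpa using pr_dist hQ hC (hθ μ) (hθ ν)
    refine squeeze_zero (fun _ => dist_nonneg) hb ?_
    have hc : Continuous (fun ν => gronwallBound 0 (2 * (C + |μ|)) |ν - μ| 1) :=
      (gronwallBound_continuous_ε 0 (2 * (C + |μ|)) 1).comp (by fun_prop)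
    have := hc.tendsto μ
    simpa [gronwallBound_ε0_δ0] using this
  have hlt : θ lam 1 < Real.pi := by
    by_contra hge
    push Not at hge
    have hμ0 : min lam 0 - 1 < 0 := by linarith [min_le_right lam 0]
    have hle : min lam 0 - 1 ≤ lam := by linarith [min_le_left lam 0]
    obtain ⟨μ, hμ, e⟩ := intermediate_value_Icc hle hcont.continuousOn
      ⟨(pr_neg hμ0 (hθ _)).le, hge⟩
    refine absurd (hlam μ ?_) (not_lt.2 hμ.2)
    obtain ⟨w, q, R, hR, hw, hd⟩ := pr_sol hQc (hθ μ)
    have hDw : ∀ t ∈ Icc (0:ℝ) 1, p t * Dv w t = q t := by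
      intro t ht
      rw [Dv_eq ht (hd t ht).1, hQe t ht]
      have := (hp t ht).ne'
      field_simp
    have hqd : ∀ t ∈ Icc (0:ℝ) 1,
        HasDerivWithinAt (fun t => p t * Dv w t) (-μ * w t) (Icc 0 1) t := fun t ht =>
      (hd t ht).2.congr hDw (hDw t ht)
    have hwc : ContinuousOn w (Icc 0 1) := fun t ht => (hd t ht).1.continuousWithinAt
    have hqc : ContinuousOn q (Icc 0 1) := fun t ht => (hd t ht).2.continuousWithinAt
    refine ⟨w, ?_, ?_, ?_, ?_, ?_, ?_⟩
    · exact cd_one (fun t ht => (hd t ht).1) (hQc.continuousOn.mul hqc)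
    · exact cd_one hqd (by fun_prop)
    · intro t ht
      rw [Dv_eq ht (hqd t ht)]; ring
    · by_contra hn
      unfold Nontriv at hn
      push Not at hn
      have h0 : (0:ℝ) ∈ Icc (0:ℝ) 1 := by simp
      obtain ⟨t, ht, et⟩ := intermediate_value_Icc (zero_le_one' ℝ) (hθ μ).cont
        (show Real.pi / 2 ∈ Icc (θ μ 0) (θ μ 1) by
          have e' : θ μ 1 = Real.pi := e
          rw [(hθ μ).1, e']; constructor <;> linarith [Real.pi_pos])
      have := hn t ht
      rw [hw, et, Real.sin_pi_div_two] at this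
      linarith [hR t]
    · rw [hw, (hθ μ).1]; simp
    · have e' : θ μ 1 = Real.pi := e
      rw [hw, e']; simp
  obtain ⟨a, ha, φ, hφ, hφ1⟩ : ∃ a, 0 < a ∧ ∃ φ, IsPr Q lam a φ ∧ φ 1 < Real.pi := by
    set E := Real.exp (2 * (C + |lam|)) with hE
    have hEp : 0 < E := Real.exp_pos _
    refine ⟨(Real.pi - θ lam 1) / (2 * E), by have := sub_pos.2 hlt; positivity, ?_⟩
    obtain ⟨φ, hφ⟩ := exists_pr Q C hQc hQ hC lam ((Real.pi - θ lam 1) / (2 * E))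
    refine ⟨φ, hφ, ?_⟩
    have := pr_dist hQ hC hφ (hθ lam)
    have hp' : 0 < (Real.pi - θ lam 1) / (2 * E) := by have := sub_pos.2 hlt; positivity
    rw [sub_self, abs_zero, gronwallBound_ε0, mul_one, ← hE, sub_zero, abs_of_pos hp'] at this
    have e : (Real.pi - θ lam 1) / (2 * E) * E = (Real.pi - θ lam 1) / 2 := by
      field_simp
    rw [e] at this
    have := (abs_le.1 this).2
    linarith
  obtain ⟨w, q, R, hR, hw, hd⟩ := pr_sol hQc hφ
  refine ⟨w, q, fun t ht => ⟨?_, ?_, (hd t ht).2⟩⟩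
  · rw [hw]
    refine mul_pos (hR t) (Real.sin_pos_of_pos_of_lt_pi ?_ ?_)
    · rcases ht.1.eq_or_lt with h0 | h0
      · rw [← h0, hφ.1]; exact ha
      · exact pr_pos hQ hφ ha.le ⟨h0, ht.2⟩
    · by_contra hge
      push Not at hge
      have := pr_fence hQ hφ Real.sin_pi ht hge 1 ⟨ht.2, le_rfl⟩
      linarith
  · refine (hd t ht).1.congr_deriv ?_
    rw [hQe t ht]; ring

def Sys (A B R : ℝ → ℝ) (κ : ℝ) (y v u z : ℝ → ℝ) : Prop := ∀ t ∈ Icc (0:ℝ) 1,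
  HasDerivWithinAt y (A t * v t) (Icc 0 1) t ∧ HasDerivWithinAt v (B t * u t) (Icc 0 1) t ∧
  HasDerivWithinAt u (A t * z t) (Icc 0 1) t ∧ HasDerivWithinAt z (κ * R t * y t) (Icc 0 1) t

lemma Sys.comb {A B R : ℝ → ℝ} {κ : ℝ} {y v u z y' v' u' z' : ℝ → ℝ} (h : Sys A B R κ y v u z)
    (h' : Sys A B R κ y' v' u' z') (a b : ℝ) :
    Sys A B R κ (fun t => a * y t + b * y' t) (fun t => a * v t + b * v' t)
      (fun t => a * u t + b * u' t) (fun t => a * z t + b * z' t) := by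
  intro t ht
  obtain ⟨h1, h2, h3, h4⟩ := h t ht
  obtain ⟨g1, g2, g3, g4⟩ := h' t ht
  refine ⟨?_, ?_, ?_, ?_⟩
  · exact ((h1.const_mul a).add (g1.const_mul b)).congr_deriv (by ring)
  · exact ((h2.const_mul a).add (g2.const_mul b)).congr_deriv (by ring)
  · exact ((h3.const_mul a).add (g3.const_mul b)).congr_deriv (by ring)
  · exact ((h4.const_mul a).add (g4.const_mul b)).congr_deriv (by ring)

lemma mono_aux {f f' : ℝ → ℝ} (h : ∀ t ∈ Icc (0:ℝ) 1, HasDerivWithinAt f (f' t) (Icc 0 1) t)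
    {T : ℝ} (hT : T ≤ 1) (hf : ∀ t ∈ Ioo 0 T, 0 ≤ f' t) : ∀ t ∈ Icc 0 T, f 0 ≤ f t := by
  have hsub : Icc 0 T ⊆ Icc 0 1 := Icc_subset_Icc_right hT
  have hm : MonotoneOn f (Icc 0 T) := by
    refine monotoneOn_of_hasDerivWithinAt_nonneg (f' := f') (convex_Icc 0 T)
      (fun t ht => (h t (hsub ht)).continuousWithinAt.mono hsub) ?_ ?_
    · intro x hx
      have := interior_subset hx
      exact (h x (hsub this)).mono (interior_subset.trans hsub)
    · intro x hx
      rw [interior_Icc] at hx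
      exact hf x hx
  intro t ht
  exact hm ⟨le_rfl, ht.1.trans ht.2⟩ ht ht.1

lemma Sys.pos {A B R : ℝ → ℝ} {κ : ℝ} {y v u z : ℝ → ℝ} (h : Sys A B R κ y v u z)
    (hA : ∀ t ∈ Icc (0:ℝ) 1, 0 < A t) (hB : ∀ t ∈ Icc (0:ℝ) 1, 0 < B t)
    (hR : ∀ t ∈ Icc (0:ℝ) 1, 0 < R t) (hκ : 0 ≤ κ)
    (hy : y 0 = 0) (hv : v 0 = 0) (hz : z 0 = 0) (hu : 0 < u 0) : 0 < v 1 := by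
  have hup : ∀ t ∈ Icc (0:ℝ) 1, 0 < u t := by
    by_contra hne
    push Not at hne
    obtain ⟨t, ht, hut⟩ := hne
    have huc : ContinuousOn u (Icc 0 1) := fun t ht => (h t ht).2.2.1.continuousWithinAt
    have hcl : IsCompact (Icc (0:ℝ) 1 ∩ u ⁻¹' Iic 0) :=
      isCompact_Icc.of_isClosed_subset (huc.preimage_isClosed_of_isClosed isClosed_Icc isClosed_Iic)
        inter_subset_left
    obtain ⟨T, ⟨hT, hT'⟩, hleast⟩ := hcl.exists_isLeast ⟨t, ht, hut⟩
    have hpos : ∀ s ∈ Ioo 0 T, 0 ≤ u s := by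
      intro s hs
      by_contra hn
      push Not at hn
      have := hleast ⟨⟨hs.1.le, hs.2.le.trans hT.2⟩, hn.le⟩
      linarith [hs.2]
    have hin : ∀ s ∈ Ioo 0 T, s ∈ Icc (0:ℝ) 1 := fun s hs => ⟨hs.1.le, hs.2.le.trans hT.2⟩
    have h1 := mono_aux (fun t ht => (h t ht).2.1) hT.2
      (fun s hs => mul_nonneg (hB s (hin s hs)).le (hpos s hs))
    rw [hv] at h1
    have h2 := mono_aux (fun t ht => (h t ht).1) hT.2
      (fun s hs => mul_nonneg (hA s (hin s hs)).le (h1 s (Ioo_subset_Icc_self hs)))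
    rw [hy] at h2
    have h3 := mono_aux (fun t ht => (h t ht).2.2.2) hT.2
      (fun s hs => mul_nonneg (mul_nonneg hκ (hR s (hin s hs)).le) (h2 s (Ioo_subset_Icc_self hs)))
    rw [hz] at h3
    have h4 := mono_aux (fun t ht => (h t ht).2.2.1) hT.2
      (fun s hs => mul_nonneg (hA s (hin s hs)).le (h3 s (Ioo_subset_Icc_self hs)))
      T ⟨hT.1, le_rfl⟩
    have : u T ≤ 0 := hT'
    linarith
  have hs : StrictMonoOn v (Icc 0 1) := by
    refine strictMonoOn_of_hasDerivWithinAt_pos (f' := fun t => B t * u t) (convex_Icc 0 1)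
      (fun t ht => (h t ht).2.1.continuousWithinAt) ?_ ?_
    · intro x hx
      exact (h x (interior_subset hx)).2.1.mono interior_subset
    · intro x hx
      exact mul_pos (hB x (interior_subset hx)) (hup x (interior_subset hx))
  have := hs (a := 0) (b := 1) (by simp) (by simp) one_pos
  linarith

lemma Sys.uniq {A B R : ℝ → ℝ} {κ : ℝ} {y v u z : ℝ → ℝ} (h : Sys A B R κ y v u z)
    (hA : ContinuousOn A (Icc 0 1)) (hB : ContinuousOn B (Icc 0 1))
    (hR : ContinuousOn R (Icc 0 1))
    (hy : y 0 = 0) (hv : v 0 = 0) (hz : z 0 = 0) (hu : u 0 = 0) :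
    ∀ t ∈ Icc (0:ℝ) 1, y t = 0 := by
  obtain ⟨a, ha⟩ := isCompact_Icc.bddAbove_image hA.abs
  obtain ⟨b, hb⟩ := isCompact_Icc.bddAbove_image hB.abs
  obtain ⟨r, hr⟩ := isCompact_Icc.bddAbove_image hR.abs
  set K := a + b + a + |κ| * r with hK
  have hN := mono_aux (f := fun t => -((y t ^ 2 + v t ^ 2 + u t ^ 2 + z t ^ 2) * Real.exp (-K * t)))
    (f' := fun t => -((2 * y t * (A t * v t) + 2 * v t * (B t * u t) + 2 * u t * (A t * z t)
        + 2 * z t * (κ * R t * y t)) * Real.exp (-K * t)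
        + (y t ^ 2 + v t ^ 2 + u t ^ 2 + z t ^ 2) * (Real.exp (-K * t) * -K))) ?_ le_rfl ?_
  · intro t ht
    have := hN t ht
    simp only [hy, hv, hz, hu] at this
    have hexp := Real.exp_pos (-K * t)
    have h1 : (y t ^ 2 + v t ^ 2 + u t ^ 2 + z t ^ 2) * Real.exp (-K * t) ≤ 0 := by
      norm_num at this ⊢
      linarith
    have h2 : y t ^ 2 + v t ^ 2 + u t ^ 2 + z t ^ 2 ≤ 0 := by
      by_contra hn
      push Not at hn
      have := mul_pos hn hexp
      linarith
    have hle : y t ^ 2 ≤ 0 := by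
      nlinarith [sq_nonneg (v t), sq_nonneg (u t), sq_nonneg (z t)]
    have : y t ^ 2 = 0 := le_antisymm hle (sq_nonneg _)
    exact pow_eq_zero_iff two_ne_zero |>.1 this
  · intro t ht
    obtain ⟨h1, h2, h3, h4⟩ := h t ht
    have he : HasDerivWithinAt (fun t => Real.exp (-K * t)) (Real.exp (-K * t) * -K) (Icc 0 1) t := by
      have := ((hasDerivWithinAt_id t (Icc (0:ℝ) 1)).const_mul (-K)).exp
      exact this.congr_deriv (by simp)
    refine (((((h1.pow 2).add (h2.pow 2)).add (h3.pow 2)).add (h4.pow 2)).mul he).neg.congr_deriv ?_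
    simp
  · intro t ht
    have ht' := Ioo_subset_Icc_self ht
    have hexp := Real.exp_pos (-K * t)
    have hat : |A t| ≤ a := ha ⟨t, ht', rfl⟩
    have hbt : |B t| ≤ b := hb ⟨t, ht', rfl⟩
    have hrt : |R t| ≤ r := hr ⟨t, ht', rfl⟩
    have key : ∀ (k k' x w n : ℝ), |k| ≤ k' → x ^ 2 + w ^ 2 ≤ n → 2 * x * (k * w) ≤ k' * n := by
      intro k k' x w n hk hn
      have hk0 : 0 ≤ k' := (abs_nonneg k).trans hk
      calc 2 * x * (k * w) ≤ |2 * x * (k * w)| := le_abs_self _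
        _ = |k| * (2 * |x| * |w|) := by simp only [abs_mul, abs_two]; ring
        _ ≤ k' * (2 * |x| * |w|) := by gcongr
        _ ≤ k' * n := by
          gcongr
          nlinarith [sq_abs x, sq_abs w, sq_nonneg (|x| - |w|)]
    set N := y t ^ 2 + v t ^ 2 + u t ^ 2 + z t ^ 2 with hNdef
    have k1 := key (A t) a (y t) (v t) N hat (by rw [hNdef]; nlinarith [sq_nonneg (u t), sq_nonneg (z t)])
    have k2 := key (B t) b (v t) (u t) N hbt (by rw [hNdef]; nlinarith [sq_nonneg (y t), sq_nonneg (z t)])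
    have k3 := key (A t) a (u t) (z t) N hat (by rw [hNdef]; nlinarith [sq_nonneg (y t), sq_nonneg (v t)])
    have k4 := key (κ * R t) (|κ| * r) (z t) (y t) N (by rw [abs_mul]; gcongr)
      (by rw [hNdef]; nlinarith [sq_nonneg (u t), sq_nonneg (v t)])
    have : 0 ≤ (K * N - (2 * y t * (A t * v t) + 2 * v t * (B t * u t) + 2 * u t * (A t * z t)
        + 2 * z t * (κ * R t * y t))) * Real.exp (-K * t) := by
      apply mul_nonneg _ hexp.le
      rw [hK]; linarith
    linarith

lemma Sys.energy {A B R : ℝ → ℝ} {κ : ℝ} {y v u z : ℝ → ℝ} (h : Sys A B R κ y v u z)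
    (hB : ∀ t ∈ Icc (0:ℝ) 1, 0 < B t)
    (hR : ∀ t ∈ Icc (0:ℝ) 1, 0 < R t) (hκ : κ ≤ 0)
    (hy : y 0 = 0) (hv : v 0 = 0) (hy1 : y 1 = 0) (hv1 : v 1 = 0) :
    ∀ t ∈ Icc (0:ℝ) 1, y t = 0 := by
  have hd : ∀ t ∈ Icc (0:ℝ) 1, HasDerivWithinAt (fun t => u t * v t - z t * y t)
      (B t * u t ^ 2 - κ * R t * y t ^ 2) (Icc 0 1) t := by
    intro t ht
    obtain ⟨h1, h2, h3, h4⟩ := h t ht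
    exact ((h3.mul h2).sub (h4.mul h1)).congr_deriv (by ring)
  have hb : ∀ t ∈ Icc (0:ℝ) 1, 0 ≤ B t * u t ^ 2 := fun t ht => mul_nonneg (hB t ht).le (sq_nonneg _)
  have hr : ∀ t ∈ Icc (0:ℝ) 1, κ * R t * y t ^ 2 ≤ 0 := fun t ht =>
    mul_nonpos_of_nonpos_of_nonneg (mul_nonpos_of_nonpos_of_nonneg hκ (hR t ht).le) (sq_nonneg _)
  have hm : MonotoneOn (fun t => u t * v t - z t * y t) (Icc 0 1) := by
    refine monotoneOn_of_hasDerivWithinAt_nonneg (convex_Icc 0 1)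
      (f' := fun t => B t * u t ^ 2 - κ * R t * y t ^ 2)
      (fun t ht => (hd t ht).continuousWithinAt)
      (fun t ht => (hd t (interior_subset ht)).mono interior_subset) ?_
    intro t ht
    have := hb t (interior_subset ht)
    have := hr t (interior_subset ht)
    linarith
  have hz : ∀ t ∈ Icc (0:ℝ) 1, u t * v t - z t * y t = 0 := by
    intro t ht
    have h1 := hm (a := 0) (by simp) ht ht.1
    have h2 := hm (b := 1) ht (by simp) ht.2
    simp only [hy, hv, hy1, hv1] at h1 h2
    linarith
  have hu0 : ∀ t ∈ Icc (0:ℝ) 1, u t = 0 := by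
    intro t ht
    have hc : HasDerivWithinAt (fun t => u t * v t - z t * y t) 0 (Icc 0 1) t :=
      (hasDerivWithinAt_const t (Icc (0:ℝ) 1) (0:ℝ)).congr hz (hz t ht)
    have e := (uniq01 ht).eq_deriv _ hc (hd t ht)
    have h1 := hb t ht
    have h2 := hr t ht
    have : B t * u t ^ 2 = 0 := by linarith
    rcases mul_eq_zero.1 this with h | h
    · exact absurd h (hB t ht).ne'
    · exact pow_eq_zero_iff two_ne_zero |>.1 h
  have hv0 : ∀ t ∈ Icc (0:ℝ) 1, v t = 0 := by
    intro t ht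
    rw [← hv]
    refine constant_of_has_deriv_right_zero (b := 1)
      (fun t ht => (h t ht).2.1.continuousWithinAt) ?_ t ht
    intro x hx
    have := (h x (Ico_subset_Icc_self hx)).2.1
    rw [hu0 x (Ico_subset_Icc_self hx), mul_zero] at this
    exact toIci this hx
  intro t ht
  rw [← hy]
  refine constant_of_has_deriv_right_zero (b := 1)
    (fun t ht => (h t ht).1.continuousWithinAt) ?_ t ht
  intro x hx
  have := (h x (Ico_subset_Icc_self hx)).1
  rw [hv0 x (Ico_subset_Icc_self hx), mul_zero] at this
  exact toIci this hx

lemma exists_comb (s t : ℝ) : ∃ a b : ℝ, (a ≠ 0 ∨ b ≠ 0) ∧ a * s + b * t = 0 := by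
  by_cases hs : s = 0
  · exact ⟨1, 0, Or.inl one_ne_zero, by simp [hs]⟩
  · exact ⟨t, -s, Or.inr (neg_ne_zero.2 hs), by ring⟩

lemma sys_dep {A B R : ℝ → ℝ} {κ : ℝ} {y v u z y' v' u' z' : ℝ → ℝ} (h : Sys A B R κ y v u z)
    (h' : Sys A B R κ y' v' u' z')
    (hAc : ContinuousOn A (Icc 0 1)) (hBc : ContinuousOn B (Icc 0 1))
    (hRc : ContinuousOn R (Icc 0 1))
    (hA : ∀ t ∈ Icc (0:ℝ) 1, 0 < A t) (hB : ∀ t ∈ Icc (0:ℝ) 1, 0 < B t)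
    (hR : ∀ t ∈ Icc (0:ℝ) 1, 0 < R t)
    (hy : y 0 = 0) (hv : v 0 = 0) (hv1 : v 1 = 0)
    (hy' : y' 0 = 0) (hv' : v' 0 = 0) (hv1' : v' 1 = 0) : LinDep y y' := by
  rcases le_total 0 κ with hκ | hκ
  · obtain ⟨a, b, hab, e⟩ := exists_comb (z 0) (z' 0)
    refine ⟨a, b, hab, ?_⟩
    have H := h.comb h' a b
    rcases lt_trichotomy (a * u 0 + b * u' 0) 0 with hu | hu | hu
    · have H2 := h.comb h' (-a) (-b)
      have := H2.pos hA hB hR hκ (by simp [hy, hy']) (by simp [hv, hv'])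
        (by linarith) (by linarith)
      simp [hv1, hv1'] at this
    · exact H.uniq hAc hBc hRc (by simp [hy, hy']) (by simp [hv, hv']) e hu
    · have := H.pos hA hB hR hκ (by simp [hy, hy']) (by simp [hv, hv']) e hu
      simp [hv1, hv1'] at this
  · obtain ⟨a, b, hab, e⟩ := exists_comb (y 1) (y' 1)
    exact ⟨a, b, hab, (h.comb h' a b).energy hB hR hκ (by simp [hy, hy']) (by simp [hv, hv']) e
      (by simp [hv1, hv1'])⟩

lemma hd_Dv {f : ℝ → ℝ} {n : WithTop ℕ∞} (hn : n ≠ 0) (h : ContDiffOn ℝ n f (Icc 0 1)) :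
    ∀ t ∈ Icc (0:ℝ) 1, HasDerivWithinAt f (Dv f t) (Icc 0 1) t :=
  fun t ht => (h.differentiableOn hn t ht).hasDerivWithinAt

lemma cd_Dv {f : ℝ → ℝ} (h : ContDiffOn ℝ 2 f (Icc 0 1)) : ContDiffOn ℝ 1 (Dv f) (Icc 0 1) :=
  h.derivWithin (uniqueDiffOn_Icc zero_lt_one) (by norm_num)

lemma SolT.sys {p r : ℝ → ℝ} {c lam : ℝ} {y h q : ℝ → ℝ} (hy : SolT p r c lam y)
    (hp : ∀ x ∈ Icc (0:ℝ) 1, 0 < p x)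
    (hh : ∀ t ∈ Icc (0:ℝ) 1, 0 < h t ∧ HasDerivWithinAt h (q t / p t) (Icc 0 1) t ∧
      HasDerivWithinAt q (-lam * h t) (Icc 0 1) t) :
    ∃ u z : ℝ → ℝ, Sys h (fun t => 1 / (p t * h t ^ 2)) r (lam * c) y (fun t => Dv y t / h t) u z := by
  obtain ⟨h1, h2, h3⟩ := hy
  refine ⟨fun t => (p t * Dv (Dv y) t) * h t - Dv y t * q t,
    fun t => Dv (fun x => p x * Dv (Dv y) x) t + lam * Dv y t, ?_⟩
  intro t ht
  have e := h3 t ht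
  obtain ⟨hpos, hd, qd⟩ := hh t ht
  have hp0 := (hp t ht).ne'
  have hh0 := hpos.ne'
  have d1 := hd_Dv two_ne_zero h1 t ht
  have d2 := hd_Dv one_ne_zero (cd_Dv h1) t ht
  have d3 := hd_Dv two_ne_zero h2 t ht
  have d4 := hd_Dv one_ne_zero (cd_Dv h2) t ht
  refine ⟨?_, ?_, ?_, ?_⟩
  · refine d1.congr_deriv ?_
    field_simp
  · refine (d2.div hd hh0).congr_deriv ?_
    field_simp
  · refine ((d3.mul hd).sub (d2.mul qd)).congr_deriv ?_
    field_simp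
    ring
  · refine (d4.add (d2.const_mul lam)).congr_deriv ?_
    linarith

theorem stmt_11 (p r : ℝ → ℝ) (c alpha lam : ℝ)
    (hpc : ContinuousOn p (Icc 0 1)) (hrc : ContinuousOn r (Icc 0 1))
    (hp : ∀ x ∈ Icc (0:ℝ) 1, 0 < p x) (hr : ∀ x ∈ Icc (0:ℝ) 1, 0 < r x)
    (hlam : lam ∈ AdmSet p) :
    (∀ y₁ y₂ : ℝ → ℝ, SolT p r c lam y₁ → BC1 y₁ → SolT p r c lam y₂ → BC1 y₂ →
      LinDep y₁ y₂) ∧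
    (∀ y₁ y₂ : ℝ → ℝ, SolT p r c lam y₁ → BC2 p lam alpha y₁ →
      SolT p r c lam y₂ → BC2 p lam alpha y₂ → LinDep y₁ y₂) := by
  obtain ⟨h, q, hh⟩ := exists_pos_sol p lam hpc hp hlam
  have hhc : ContinuousOn h (Icc 0 1) := fun t ht => (hh t ht).2.1.continuousWithinAt
  have hBp : ∀ t ∈ Icc (0:ℝ) 1, 0 < p t * h t ^ 2 := fun t ht =>
    mul_pos (hp t ht) (pow_pos (hh t ht).1 2)
  have main : ∀ y₁ y₂ : ℝ → ℝ, SolT p r c lam y₁ → SolT p r c lam y₂ →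
      y₁ 0 = 0 → Dv y₁ 0 = 0 → Dv y₁ 1 = 0 → y₂ 0 = 0 → Dv y₂ 0 = 0 → Dv y₂ 1 = 0 →
      LinDep y₁ y₂ := by
    intro y₁ y₂ s1 s2 a1 a2 a3 b1 b2 b3
    obtain ⟨u, z, S⟩ := s1.sys hp hh
    obtain ⟨u', z', S'⟩ := s2.sys hp hh
    exact sys_dep S S' hhc
      (continuousOn_const.div (hpc.mul (hhc.pow 2)) (fun t ht => (hBp t ht).ne')) hrc
      (fun t ht => (hh t ht).1) (fun t ht => one_div_pos.2 (hBp t ht)) hr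
      a1 (by simp [a2]) (by simp [a3]) b1 (by simp [b2]) (by simp [b3])
  exact ⟨fun y₁ y₂ s1 b1 s2 b2 => main y₁ y₂ s1 s2 b1.1 b1.2.1 b1.2.2.2 b2.1 b2.2.1 b2.2.2.2,
    fun y₁ y₂ s1 b1 s2 b2 => main y₁ y₂ s1 s2 b1.1 b1.2.1 b1.2.2.1 b2.1 b2.2.1 b2.2.2.1⟩
end

section
/- Let p, r : [0,1] → ℝ be continuous with p(x) > 0 and r(x) > 0 for all x ∈ [0,1], and let c, α ∈ ℝ. Then: (i) every negative eigenvalue of the problem (E_T) with boundary conditions (BC1), and every negative eigenvalue of (E_T) with boundary conditions (BC2), belongs to Λ(p); (ii) if moreover c > 0 and α ≥ 0, and λ > 0 is an eigenvalue of (E_T) with boundary conditions (BC2) such that no μ with 0 < μ < λ is an eigenvalue of that problem, then λ ∈ Λ(p). -/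
open Set

/-- `lam` is an eigenvalue of the problem (E_T), (BC1). -/
def EigT1 (p r : ℝ → ℝ) (c lam : ℝ) : Prop :=
  ∃ y : ℝ → ℝ, SolT p r c lam y ∧ Nontriv y ∧ BC1 y

/-- `lam` is an eigenvalue of the problem (E_T), (BC2). -/
def EigT2 (p r : ℝ → ℝ) (c alpha lam : ℝ) : Prop :=
  ∃ y : ℝ → ℝ, SolT p r c lam y ∧ Nontriv y ∧ BC2 p lam alpha y

open Filter Topology in
theorem abs_spec {E : Type*} [NormedAddCommGroup E] [NormedSpace ℝ E]
    (q : E →ₗ[ℝ] E →ₗ[ℝ] ℝ) (X : Submodule ℝ E) (T : E →L[ℝ] E)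
    (hqs : ∀ f g, q f g = q g f) (hq0 : ∀ f, 0 ≤ q f f)
    (C₂ : ℝ) (hC₂ : ∀ f, q f f ≤ C₂ * ‖f‖ ^ 2)
    (C : ℝ) (hC0 : 0 ≤ C) (hC : ∀ f, ‖T f‖ ^ 2 ≤ C * q f f)
    (hTX : ∀ f, T f ∈ X)
    (hTs : ∀ f ∈ X, ∀ g ∈ X, q (T f) g = q (T g) f)
    (hT0 : ∀ f ∈ X, 0 ≤ q (T f) f)
    (hcpt : ∀ u : ℕ → E, (∀ n, q (u n) (u n) ≤ 1) →
      ∃ g, ∃ φ : ℕ → ℕ, StrictMono φ ∧ Tendsto (fun n => T (u (φ n))) atTop (𝓝 g))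
    (ν : ℝ) (hν : 0 < ν) (f₀ : E) (hf₀ : f₀ ∈ X) (hf₀ν : ν * q f₀ f₀ < q (T f₀) f₀) :
    ∃ g M, ν < M ∧ g ≠ 0 ∧ T g = M • g := by
  -- Cauchy-Schwarz
  have disc : ∀ a b c : ℝ, (∀ t : ℝ, 0 ≤ a + 2 * t * b + t ^ 2 * c) → b ^ 2 ≤ a * c := by
    intro a b c h
    have := discrim_le_zero (a := c) (b := 2 * b) (c := a) (fun x => by
      have := h x; nlinarith)
    unfold discrim at this
    nlinarith
  have cs : ∀ f g, (q f g) ^ 2 ≤ q f f * q g g := by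
    intro f g
    apply disc
    intro t
    have := hq0 (f + t • g)
    simp only [map_add, map_smul, LinearMap.add_apply, LinearMap.smul_apply, smul_eq_mul] at this
    rw [hqs g f] at this
    nlinarith
  have hCabs : ∀ f, q f f ≤ |C₂| * ‖f‖ ^ 2 := fun f =>
    (hC₂ f).trans (mul_le_mul_of_nonneg_right (le_abs_self _) (by positivity))
  have hTq : ∀ f, q (T f) (T f) ≤ |C₂| * C * q f f := fun f => by
    have h1 := hCabs (T f)
    have h2 := mul_le_mul_of_nonneg_left (hC f) (abs_nonneg C₂)
    nlinarith
  set D := |C₂| * C with hD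
  have hD0 : 0 ≤ D := by positivity
  have hB : ∀ f, (q (T f) f) ^ 2 ≤ D * (q f f) ^ 2 := fun f => by
    have h1 := cs (T f) f
    have h2 := mul_le_mul_of_nonneg_right (hTq f) (hq0 f)
    nlinarith
  set S : Set ℝ := {b | ∃ f ∈ X, q f f ≤ 1 ∧ b = q (T f) f} with hS
  have hbdd : BddAbove S := by
    refine ⟨D + 1, ?_⟩
    rintro b ⟨f, hf, hf1, rfl⟩
    have h1 := hB f
    have h2 : (q f f) ^ 2 ≤ 1 := by have := hq0 f; nlinarith
    have h3 : (q (T f) f) ^ 2 ≤ D := h1.trans (by nlinarith)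
    nlinarith [sq_nonneg (q (T f) f - 1)]
  have hne : S.Nonempty := ⟨0, 0, X.zero_mem, by simp, by simp⟩
  set M := sSup S with hM
  have hf0pos : 0 < q f₀ f₀ := by
    rcases (hq0 f₀).lt_or_eq with h | h
    · exact h
    · have := hB f₀
      rw [← h] at this hf₀ν
      have h2 : q (T f₀) f₀ = 0 := by nlinarith [sq_nonneg (q (T f₀) f₀)]
      linarith
  have hscale : ∀ f ∈ X, 0 < q f f → q (T f) f / q f f ∈ S := by
    intro f hf hpos
    have hs := Real.sq_sqrt hpos.le
    have hs0 : 0 < √(q f f) := Real.sqrt_pos.2 hpos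
    refine ⟨(√(q f f))⁻¹ • f, X.smul_mem _ hf, ?_, ?_⟩
    · simp only [map_smul, LinearMap.smul_apply, smul_eq_mul]
      rw [← mul_assoc, ← mul_inv, ← sq, hs, inv_mul_cancel₀ hpos.ne']
    · simp only [map_smul, LinearMap.smul_apply, smul_eq_mul]
      rw [← mul_assoc, ← mul_inv, ← sq, hs]
      field_simp
  have hνM : ν < M := by
    refine lt_of_lt_of_le ?_ (le_csSup hbdd (hscale f₀ hf₀ hf0pos))
    rw [lt_div_iff₀ hf0pos]; exact hf₀ν
  have hM0 : 0 < M := hν.trans hνM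
  have hle : ∀ f ∈ X, q (T f) f ≤ M * q f f := by
    intro f hf
    rcases (hq0 f).lt_or_eq with h | h
    · have := le_csSup hbdd (hscale f hf h)
      rwa [div_le_iff₀ h] at this
    · have := hB f
      rw [← h] at this ⊢
      nlinarith [sq_nonneg (q (T f) f)]
  have key : ∀ f ∈ X, q f f ≤ 1 → q (M • f - T f) (M • f - T f) ≤ M * (M - q (T f) f) := by
    intro f hf hf1
    set h := M • f - T f with hh
    have hhX : h ∈ X := X.sub_mem (X.smul_mem _ hf) (hTX f)
    have e1all : ∀ k, q h k = M * q f k - q (T f) k := fun k => by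
      rw [hh]
      simp only [map_sub, map_smul, LinearMap.sub_apply, LinearMap.smul_apply, smul_eq_mul]
    have e1 := e1all h
    have h2 : (M * q f h - q (T f) h) ^ 2 ≤
        (M * q f f - q (T f) f) * (M * q h h - q (T h) h) := by
      apply disc
      intro t
      have := hle (f + t • h) (X.add_mem hf (X.smul_mem _ hhX))
      simp only [map_add, map_smul, LinearMap.add_apply, LinearMap.smul_apply, smul_eq_mul] at this
      rw [hqs h f, hTs h hhX f hf] at this
      nlinarith
    rw [← e1] at h2
    have h3 := hT0 h hhX
    have h4 := hle f hf
    have h5 := hle h hhX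
    have h6 : q h h ^ 2 ≤ (M - q (T f) f) * (M * q h h) := by
      refine h2.trans ?_
      apply mul_le_mul <;> nlinarith [hq0 h]
    rcases (hq0 h).lt_or_eq with h7 | h7
    · by_contra hcon
      push Not at hcon
      nlinarith
    · rw [← h7]; apply mul_nonneg hM0.le; nlinarith
  -- maximizing sequence
  obtain ⟨b, -, hb, hbS⟩ := exists_seq_tendsto_sSup hne hbdd
  choose u huX hu1 hub using hbS
  obtain ⟨g, φ, hφ, hg⟩ := hcpt u hu1
  have hbφ : Tendsto (fun n => q (T (u (φ n))) (u (φ n))) atTop (𝓝 M) := by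
    have := hb.comp hφ.tendsto_atTop
    refine this.congr fun n => ?_
    simp [hub]
  refine ⟨g, M, hνM, ?_, ?_⟩
  · rintro rfl
    have h1 : Tendsto (fun n => |C₂| * ‖T (u (φ n))‖ ^ 2) atTop (𝓝 (|C₂| * ‖(0:E)‖ ^ 2)) :=
      (hg.norm.pow 2).const_mul _
    have h2 := hbφ.pow 2
    have h3 : M ^ 2 ≤ |C₂| * ‖(0:E)‖ ^ 2 := le_of_tendsto_of_tendsto' h2 h1 fun n => by
      refine (cs _ _).trans ?_
      have a1 := hCabs (T (u (φ n)))
      have a2 := hu1 (φ n)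
      have a3 := hq0 (T (u (φ n)))
      nlinarith
    simp at h3
    nlinarith
  · have h1 : Tendsto (fun n => T (M • u (φ n) - T (u (φ n)))) atTop (𝓝 (M • g - T g)) := by
      simp only [map_sub, map_smul]
      exact (hg.const_smul M).sub ((T.continuous.tendsto g).comp hg)
    have h2 : Tendsto (fun n => C * (M * (M - q (T (u (φ n))) (u (φ n))))) atTop
        (𝓝 (C * (M * (M - M)))) := ((hbφ.const_sub M).const_mul M).const_mul C
    have h3 : ‖M • g - T g‖ ^ 2 ≤ C * (M * (M - M)) :=
      le_of_tendsto_of_tendsto' (h1.norm.pow 2) h2 fun n =>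
        (hC _).trans (mul_le_mul_of_nonneg_left (key _ (huX _) (hu1 _)) hC0)
    have h4 : ‖M • g - T g‖ = 0 := by
      have : ‖M • g - T g‖ ^ 2 ≤ 0 := by simpa using h3
      exact pow_eq_zero_iff (two_ne_zero) |>.1 (le_antisymm this (by positivity))
    exact (sub_eq_zero.1 (norm_eq_zero.1 h4)).symm
open Filter Topology MeasureTheory

abbrev EE := BoundedContinuousFunction (Icc (0:ℝ) 1) ℝ

theorem zero_mem01 : (0:ℝ) ∈ Icc (0:ℝ) 1 := ⟨le_rfl, zero_le_one⟩
theorem one_mem01 : (1:ℝ) ∈ Icc (0:ℝ) 1 := ⟨zero_le_one, le_rfl⟩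

/-- Extension of a continuous function on `[0,1]` to the line. -/
noncomputable def exE (f : EE) : ℝ → ℝ := fun t => f (projIcc 0 1 zero_le_one t)

theorem exE_cont (f : EE) : Continuous (exE f) := f.continuous.comp continuous_projIcc

theorem exE_of_mem (f : EE) {x : ℝ} (hx : x ∈ Icc (0:ℝ) 1) : exE f x = f ⟨x, hx⟩ := by
  simp only [exE, projIcc_of_mem zero_le_one hx]

theorem exE_ii (f : EE) (a b : ℝ) : IntervalIntegrable (exE f) volume a b :=
  (exE_cont f).intervalIntegrable a b

theorem exE_le (f : EE) (x : ℝ) : ‖exE f x‖ ≤ ‖f‖ := f.norm_coe_le_norm _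

/-- Restriction of a function continuous on `[0,1]`. -/
noncomputable def toE (u : ℝ → ℝ) (hu : ContinuousOn u (Icc 0 1)) : EE :=
  BoundedContinuousFunction.mkOfCompact ⟨fun x => u x, continuousOn_iff_continuous_domRestrict.1 hu⟩

theorem toE_apply (u : ℝ → ℝ) (hu : ContinuousOn u (Icc 0 1)) (x : Icc (0:ℝ) 1) :
    toE u hu x = u x := rfl

theorem exE_toE (u : ℝ → ℝ) (hu : ContinuousOn u (Icc 0 1)) {x : ℝ} (hx : x ∈ Icc (0:ℝ) 1) :
    exE (toE u hu) x = u x := by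
  rw [exE_of_mem _ hx]; rfl

/-- The primitive on the line. -/
noncomputable def prim (f : EE) : ℝ → ℝ := fun x => ∫ t in (0:ℝ)..x, exE f t

theorem prim_deriv (f : EE) (x : ℝ) : HasDerivAt (prim f) (exE f x) x :=
  intervalIntegral.integral_hasDerivAt_right (exE_ii f _ _)
    ((exE_cont f).stronglyMeasurableAtFilter _ _) (exE_cont f).continuousAt

theorem prim_cont (f : EE) : Continuous (prim f) :=
  continuous_iff_continuousAt.2 fun x => (prim_deriv f x).continuousAt

theorem prim_sub (f : EE) (x y : ℝ) : prim f y - prim f x = ∫ t in x..y, exE f t := by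
  unfold prim
  rw [intervalIntegral.integral_interval_sub_left (exE_ii f _ _) (exE_ii f _ _)]

/-- The Volterra operator. -/
noncomputable def VV : EE →L[ℝ] EE :=
  LinearMap.mkContinuous
    { toFun := fun f => toE (prim f) (prim_cont f).continuousOn
      map_add' := fun f g => by
        ext x
        simp only [BoundedContinuousFunction.coe_add, Pi.add_apply, toE_apply, prim]
        rw [← intervalIntegral.integral_add (exE_ii f _ _) (exE_ii g _ _)]
        rfl
      map_smul' := fun a f => by
        ext x
        simp only [BoundedContinuousFunction.coe_smul, toE_apply, prim, RingHom.id_apply, smul_eq_mul]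
        rw [← intervalIntegral.integral_const_mul]
        rfl } 1 (by
    intro f
    rw [one_mul]
    refine (BoundedContinuousFunction.norm_le (norm_nonneg _)).2 fun x => ?_
    have : ‖∫ t in (0:ℝ)..x, exE f t‖ ≤ ‖f‖ * |(x:ℝ) - 0| :=
      intervalIntegral.norm_integral_le_of_norm_le_const fun t _ => exE_le f t
    refine this.trans ?_
    have h0 := x.2.1
    have h1 := x.2.2
    rw [sub_zero, abs_of_nonneg h0]
    exact mul_le_of_le_one_right (norm_nonneg _) h1)

theorem VV_apply (f : EE) (x : Icc (0:ℝ) 1) : VV f x = prim f x := rfl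

theorem exE_VV (f : EE) {x : ℝ} (hx : x ∈ Icc (0:ℝ) 1) : exE (VV f) x = prim f x := by
  rw [exE_of_mem _ hx]; rfl

/-- Evaluation at one. -/
noncomputable def ev1 : EE →L[ℝ] ℝ := BoundedContinuousFunction.evalCLM ℝ ⟨1, one_mem01⟩

/-- The integral over `[0,1]`. -/
noncomputable def II : EE →L[ℝ] ℝ := ev1 ∘L VV

theorem ev1_apply (f : EE) : ev1 f = f ⟨1, one_mem01⟩ := rfl

theorem II_apply (f : EE) : II f = ∫ t in (0:ℝ)..1, exE f t := rfl

theorem II_mono {f g : EE} (h : ∀ x, f x ≤ g x) : II f ≤ II g := by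
  rw [II_apply, II_apply]
  exact intervalIntegral.integral_mono_on zero_le_one (exE_ii f _ _) (exE_ii g _ _) fun x _ => h _

theorem II_nonneg {f : EE} (h : ∀ x, 0 ≤ f x) : 0 ≤ II f := by
  have := II_mono (f := 0) (g := f) h
  simpa using this

theorem II_pos {f : EE} (h : ∀ x, 0 ≤ f x) (x : Icc (0:ℝ) 1) (hx : 0 < f x) : 0 < II f := by
  rw [II_apply]
  refine intervalIntegral.integral_pos zero_lt_one (exE_cont f).continuousOn (fun x _ => h _) ⟨x, x.2, ?_⟩
  rw [exE_of_mem f x.2]; exact hx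

/-- Multiplication. -/
noncomputable def mulE (f : EE) : EE →L[ℝ] EE := ContinuousLinearMap.mul ℝ EE f

theorem mulE_apply (f g : EE) : mulE f g = f * g := rfl

/-- The backward primitive. -/
noncomputable def UU : EE →L[ℝ] EE := II.smulRight (1 : EE) - VV

theorem UU_apply (f : EE) : UU f = II f • (1 : EE) - VV f := rfl

theorem II_V (f g : EE) : II (VV f * g) = II f * II g - II (f * VV g) := by
  have h := intervalIntegral.integral_mul_deriv_eq_deriv_mul (a := 0) (b := 1)
    (u := prim f) (v := prim g) (u' := exE f) (v' := exE g)
    (fun x _ => prim_deriv f x) (fun x _ => prim_deriv g x) (exE_ii f _ _) (exE_ii g _ _)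
  have e0 : prim f 0 = 0 := by simp [prim]
  rw [e0, zero_mul, sub_zero] at h
  have e1 : II (VV f * g) = ∫ x in (0:ℝ)..1, prim f x * exE g x := by
    rw [II_apply]
    refine intervalIntegral.integral_congr fun x hx => ?_
    rw [uIcc_of_le zero_le_one] at hx
    rw [← exE_VV f hx]; rfl
  have e2 : II (f * VV g) = ∫ x in (0:ℝ)..1, exE f x * prim g x := by
    rw [II_apply]
    refine intervalIntegral.integral_congr fun x hx => ?_
    rw [uIcc_of_le zero_le_one] at hx
    rw [← exE_VV g hx]; rfl
  rw [e1, e2, h]; rfl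

theorem II_U (f g : EE) : II (UU f * g) = II (f * VV g) := by
  rw [UU_apply, sub_mul, map_sub, II_V, smul_mul_assoc, one_mul, map_smul, smul_eq_mul]
  ring

theorem cs_int (f : EE) (a b : ℝ) (hab : a ≤ b) :
    (∫ t in a..b, exE f t) ^ 2 ≤ (b - a) * ∫ t in a..b, (exE f t) ^ 2 := by
  rcases hab.eq_or_lt with rfl | hlt
  · simp
  set m := ∫ t in a..b, exE f t with hm
  have hc := exE_cont f
  have h : 0 ≤ ∫ t in a..b, ((b - a) * exE f t - m) ^ 2 :=
    intervalIntegral.integral_nonneg hab fun t _ => sq_nonneg _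
  have e : (∫ t in a..b, ((b - a) * exE f t - m) ^ 2) =
      (b - a) ^ 2 * (∫ t in a..b, (exE f t) ^ 2) - 2 * (b - a) * m * m + (b - a) * m ^ 2 := by
    have : ∀ t, ((b - a) * exE f t - m) ^ 2 =
      (b - a) ^ 2 * (exE f t) ^ 2 - 2 * (b - a) * m * exE f t + m ^ 2 := fun t => by ring
    simp_rw [this]
    rw [intervalIntegral.integral_add, intervalIntegral.integral_sub,
      intervalIntegral.integral_const_mul, intervalIntegral.integral_const_mul,
      intervalIntegral.integral_const, smul_eq_mul]
    all_goals exact Continuous.intervalIntegrable (by fun_prop) _ _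
  rw [e] at h
  have hp : 0 < b - a := sub_pos.2 hlt
  have h2 : 0 ≤ (b - a) * ((b - a) * (∫ t in a..b, (exE f t) ^ 2) - m ^ 2) := by nlinarith
  have := nonneg_of_mul_nonneg_right h2 hp
  linarith

theorem prim_holder (f : EE) {x y : ℝ} (hx : x ∈ Icc (0:ℝ) 1) (hy : y ∈ Icc (0:ℝ) 1) :
    (prim f x - prim f y) ^ 2 ≤ |x - y| * II (f * f) := by
  have main : ∀ x y : ℝ, x ∈ Icc (0:ℝ) 1 → y ∈ Icc (0:ℝ) 1 → x ≤ y →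
      (prim f x - prim f y) ^ 2 ≤ |x - y| * II (f * f) := by
    intro x y hx hy hxy
    rw [← neg_sq, neg_sub, prim_sub, abs_sub_comm, abs_of_nonneg (sub_nonneg.2 hxy)]
    refine (cs_int f x y hxy).trans (mul_le_mul_of_nonneg_left ?_ (sub_nonneg.2 hxy))
    have hc := exE_cont f
    have e : II (f * f) = ∫ t in (0:ℝ)..1, (exE f t) ^ 2 := by
      rw [II_apply]
      refine intervalIntegral.integral_congr fun t _ => ?_
      simp only [sq]; rfl
    rw [e]
    apply intervalIntegral.integral_mono_interval hx.1 hxy hy.2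
    · exact Filter.Eventually.of_forall fun t => sq_nonneg _
    · exact Continuous.intervalIntegrable (by fun_prop) _ _
  rcases le_total x y with h | h
  · exact main x y hx hy h
  · have := main y x hy hx h
    rw [abs_sub_comm]; nlinarith

theorem VV_norm (f : EE) : ‖VV f‖ ^ 2 ≤ II (f * f) := by
  have h0 : 0 ≤ II (f * f) := II_nonneg fun x => mul_self_nonneg (f x)
  have : ‖VV f‖ ≤ √(II (f * f)) := by
    refine (BoundedContinuousFunction.norm_le (Real.sqrt_nonneg _)).2 fun x => ?_
    rw [Real.norm_eq_abs]
    apply Real.abs_le_sqrt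
    have h := prim_holder f x.2 zero_mem01
    have e0 : prim f 0 = 0 := by simp [prim]
    rw [e0, sub_zero, sub_zero, abs_of_nonneg x.2.1] at h
    rw [VV_apply]
    exact h.trans (mul_le_of_le_one_left h0 x.2.2)
  calc _ ≤ √(II (f * f)) ^ 2 := by gcongr
    _ = _ := Real.sq_sqrt h0

theorem VV_cpt (K : ℝ) (u : ℕ → EE) (hu : ∀ n, II (u n * u n) ≤ K) :
    ∃ g, ∃ φ : ℕ → ℕ, StrictMono φ ∧ Tendsto (fun n => VV (u (φ n))) atTop (𝓝 g) := by
  have hc : IsCompact (closure (range fun n => VV (u n))) := by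
    refine BoundedContinuousFunction.arzela_ascoli (Metric.closedBall 0 √K)
      (isCompact_closedBall _ _) _ ?_ ?_
    · rintro _ x ⟨n, rfl⟩
      rw [mem_closedBall_zero_iff]
      refine (BoundedContinuousFunction.norm_coe_le_norm _ x).trans ?_
      exact Real.le_sqrt_of_sq_le ((VV_norm (u n)).trans (hu n))
    · refine Metric.equicontinuous_of_continuity_modulus (fun d => √(d * K)) ?_ _ ?_
      · have : Continuous fun d : ℝ => √(d * K) := by fun_prop
        simpa using this.tendsto 0
      · rintro x y ⟨_, n, rfl⟩
        simp only [VV_apply]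
        rw [Real.dist_eq]
        apply Real.abs_le_sqrt
        refine (prim_holder (u n) x.2 y.2).trans ?_
        rw [Subtype.dist_eq, Real.dist_eq]
        exact mul_le_mul_of_nonneg_left (hu n) (abs_nonneg _)
  obtain ⟨g, -, φ, hφ, h⟩ := hc.tendsto_subseq (x := fun n => VV (u n))
    (fun n => subset_closure ⟨n, rfl⟩)
  exact ⟨g, φ, hφ, h⟩

theorem uniq01_s12 : UniqueDiffOn ℝ (Icc (0:ℝ) 1) := uniqueDiffOn_Icc zero_lt_one

theorem step_deriv (u : ℝ → ℝ) (h : EE) (a : ℝ)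
    (hu : ∀ x ∈ Icc (0:ℝ) 1, u x = a + exE (VV h) x) {x : ℝ} (hx : x ∈ Icc (0:ℝ) 1) :
    HasDerivWithinAt u (exE h x) (Icc 0 1) x := by
  have h1 : HasDerivWithinAt (fun x => a + prim h x) (exE h x) (Icc 0 1) x :=
    ((prim_deriv h x).const_add a).hasDerivWithinAt
  exact h1.congr (fun z hz => by rw [hu z hz, exE_VV h hz]) (by rw [hu x hx, exE_VV h hx])

theorem step_Dv (u : ℝ → ℝ) (h : EE) (a : ℝ)
    (hu : ∀ x ∈ Icc (0:ℝ) 1, u x = a + exE (VV h) x) {x : ℝ} (hx : x ∈ Icc (0:ℝ) 1) :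
    Dv u x = exE h x :=
  (step_deriv u h a hu hx).derivWithin (uniq01_s12 x hx)

theorem step_one (u : ℝ → ℝ) (h : EE) (a : ℝ)
    (hu : ∀ x ∈ Icc (0:ℝ) 1, u x = a + exE (VV h) x) : ContDiffOn ℝ 1 u (Icc 0 1) := by
  rw [show (1 : WithTop ℕ∞) = 0 + 1 from (zero_add 1).symm, contDiffOn_succ_iff_derivWithin uniq01_s12]
  refine ⟨fun x hx => (step_deriv u h a hu hx).differentiableWithinAt, by simp, ?_⟩
  rw [contDiffOn_zero]
  exact (exE_cont h).continuousOn.congr fun x hx => step_Dv u h a hu hx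

theorem step_two (u : ℝ → ℝ) (h k : EE) (a b : ℝ)
    (hu : ∀ x ∈ Icc (0:ℝ) 1, u x = a + exE (VV h) x)
    (hk : ∀ x ∈ Icc (0:ℝ) 1, exE h x = b + exE (VV k) x) : ContDiffOn ℝ 2 u (Icc 0 1) := by
  rw [show (2 : WithTop ℕ∞) = 1 + 1 from one_add_one_eq_two.symm,
    contDiffOn_succ_iff_derivWithin uniq01_s12]
  refine ⟨fun x hx => (step_deriv u h a hu hx).differentiableWithinAt, by simp, ?_⟩
  exact (step_one (exE h) k b hk).congr fun x hx => step_Dv u h a hu hx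

theorem VV_inj (h : EE) (h0 : VV h = 0) : h = 0 := by
  ext x
  have := step_Dv (fun _ => 0) h 0 (fun x hx => by rw [h0, zero_add]; rfl) x.2
  rw [exE_of_mem h x.2] at this
  have h2 : Dv (fun _ => (0:ℝ)) x = 0 := by simp [Dv]
  rw [h2] at this
  simpa using this.symm

theorem ftc (u : ℝ → ℝ) (hu : ContDiffOn ℝ 1 u (Icc 0 1)) (hc : ContinuousOn (Dv u) (Icc 0 1))
    {x : ℝ} (hx : x ∈ Icc (0:ℝ) 1) : u x = u 0 + VV (toE (Dv u) hc) ⟨x, hx⟩ := by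
  have h := intervalIntegral.integral_eq_sub_of_hasDerivAt_of_le (f := u)
    (f' := exE (toE (Dv u) hc)) hx.1
    (hu.continuousOn.mono (Icc_subset_Icc_right hx.2)) (fun t ht => by
      have htm : t ∈ Icc (0:ℝ) 1 := ⟨ht.1.le, ht.2.le.trans hx.2⟩
      rw [exE_toE _ _ htm]
      have hd := (hu.differentiableOn one_ne_zero t htm).hasDerivWithinAt
      exact hd.hasDerivAt (Icc_mem_nhds ht.1 (ht.2.trans_le hx.2))) (exE_ii _ _ _)
  rw [VV_apply]
  change u x = u 0 + ∫ t in (0:ℝ)..x, _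
  rw [h]; ring

theorem Dv_contOn (u : ℝ → ℝ) (hu : ContDiffOn ℝ 1 u (Icc 0 1)) : ContinuousOn (Dv u) (Icc 0 1) :=
  hu.continuousOn_derivWithin uniq01_s12 le_rfl

theorem dirichlet_data (p : ℝ → ℝ) (hpc : ContinuousOn p (Icc 0 1)) (μ : ℝ)
    (h : DirichletEig p μ) : ∃ f : EE, II f = 0 ∧ VV f ≠ 0 ∧
      II (toE p hpc * f * f) = μ * II (VV f * VV f) := by
  obtain ⟨w, hw, hpw, heq, ⟨x₀, hx₀, hne⟩, hw0, hw1⟩ := h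
  set f := toE (Dv w) (Dv_contOn w hw) with hf
  have e1 : ∀ x (hx : x ∈ Icc (0:ℝ) 1), VV f ⟨x, hx⟩ = w x := fun x hx => by
    have := ftc w hw (Dv_contOn w hw) hx
    rw [hw0, zero_add] at this
    exact this.symm
  have hIf : II f = 0 := (e1 1 one_mem01).trans hw1
  refine ⟨f, hIf, fun h0 => hne ?_, ?_⟩
  · rw [← e1 x₀ hx₀, h0]; rfl
  · set a := p 0 * Dv w 0
    have e2 : toE p hpc * f = a • (1:EE) + VV ((-μ) • VV f) := by
      ext x
      have := ftc _ hpw (Dv_contOn _ hpw) x.2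
      have e3 : toE (Dv fun x => p x * Dv w x) (Dv_contOn _ hpw) = (-μ) • VV f := by
        ext z
        rw [toE_apply]
        have h1 := heq z z.2
        have h2 := e1 z z.2
        simp only [BoundedContinuousFunction.coe_smul, smul_eq_mul]
        rw [h2]; linarith
      rw [e3] at this
      simpa [toE_apply, hf] using this
    rw [e2, add_mul, map_add, smul_mul_assoc, one_mul, map_smul, hIf, smul_zero, zero_add,
      map_smul, smul_mul_assoc, map_smul, II_V, hIf, mul_zero, zero_sub, smul_eq_mul]
    ring

theorem sq_int_pos (g : EE) (hg : g ≠ 0) : 0 < II (g * g) := by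
  have : ∃ x, g x ≠ 0 := by
    by_contra hcon
    push Not at hcon
    exact hg (by ext x; simpa using hcon x)
  obtain ⟨x, hx⟩ := this
  exact II_pos (fun x => mul_self_nonneg (g x)) x (mul_self_pos.2 hx)

theorem wt_int_pos (P : EE) (hP : ∀ x, 0 < P x) (g : EE) (hg : g ≠ 0) : 0 < II (P * g * g) := by
  have : ∃ x, g x ≠ 0 := by
    by_contra hcon
    push Not at hcon
    exact hg (by ext x; simpa using hcon x)
  obtain ⟨x, hx⟩ := this
  refine II_pos (fun x => ?_) x ?_
  · have := mul_nonneg (hP x).le (mul_self_nonneg (g x))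
    simpa [mul_assoc] using this
  · have := mul_pos (hP x) (mul_self_pos.2 hx)
    simpa [mul_assoc] using this

theorem wt_int_nonneg (P : EE) (hP : ∀ x, 0 < P x) (g : EE) : 0 ≤ II (P * g * g) := by
  by_cases hg : g = 0
  · simp [hg]
  · exact (wt_int_pos P hP g hg).le

/-- The weighted form. -/
noncomputable def qf (P : EE) : EE →ₗ[ℝ] EE →ₗ[ℝ] ℝ :=
  LinearMap.mk₂ ℝ (fun f g => II (P * f * g))
    (fun f f' g => by simp only [mul_add, add_mul, map_add])
    (fun a f g => by simp only [mul_smul_comm, smul_mul_assoc, map_smul])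
    (fun f g g' => by simp only [mul_add, map_add])
    (fun a f g => by simp only [mul_smul_comm, map_smul])

theorem qf_apply (P f g : EE) : qf P f g = II (P * f * g) := rfl

/-- The part of the operator after the first integration, before applying `UU`. -/
noncomputable def HH (R : EE) (c α : ℝ) : EE →L[ℝ] EE :=
  ContinuousLinearMap.id ℝ EE + c • (UU ∘L mulE R ∘L VV) + α • ((ev1 ∘L VV).smulRight (1:EE))

theorem HH_apply (R : EE) (c α : ℝ) (w : EE) :
    HH R c α w = w + c • UU (R * VV w) + α • (ev1 (VV w) • (1:EE)) := rfl

noncomputable def TP (Q R : EE) (c α : ℝ) : EE →L[ℝ] EE :=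
  mulE Q ∘L UU ∘L HH R c α -
    ((II Q)⁻¹ • (II ∘L mulE Q ∘L UU ∘L HH R c α)).smulRight Q

theorem TP_apply (Q R : EE) (c α : ℝ) (w : EE) :
    TP Q R c α w = Q * UU (HH R c α w) - ((II Q)⁻¹ * II (Q * UU (HH R c α w))) • Q := rfl

theorem exists_eig (P Q R : EE) (hPQ : P * Q = 1) (hP : ∀ x, 0 < P x) (hQ : ∀ x, 0 < Q x)
    (hR : ∀ x, 0 < R x) (c α : ℝ) (hc : 0 < c) (hα : 0 ≤ α) (μ : ℝ) (hμ : 0 < μ)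
    (f₀ : EE) (hf₀ : II f₀ = 0) (hf₀n : VV f₀ ≠ 0)
    (hf₀e : II (P * f₀ * f₀) = μ * II (VV f₀ * VV f₀)) :
    ∃ (f : EE) (lam k : ℝ), 0 < lam ∧ lam < μ ∧ f ≠ 0 ∧ II f = 0 ∧
      P * f = lam • UU (HH R c α (VV f)) + k • (1:EE) := by
  have hIQ : 0 < II Q := II_pos (fun x => (hQ x).le) ⟨0, zero_mem01⟩ (hQ _)
  set T := TP Q R c α ∘L VV with hT
  have hTX : ∀ f, II (T f) = 0 := fun f => by
    change II (TP Q R c α (VV f)) = 0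
    rw [TP_apply, map_sub, map_smul, smul_eq_mul]
    field_simp
    ring
  have hPT : ∀ f, P * T f = UU (HH R c α (VV f)) -
      ((II Q)⁻¹ * II (Q * UU (HH R c α (VV f)))) • (1:EE) := fun f => by
    change P * (TP Q R c α (VV f)) = _
    rw [TP_apply, mul_sub, ← mul_assoc, hPQ, one_mul, mul_smul_comm, hPQ]
  have hqT : ∀ f g, II g = 0 → qf P (T f) g = II (VV f * VV g) +
      c * II (R * VV (VV f) * VV (VV g)) + α * (ev1 (VV (VV f)) * ev1 (VV (VV g))) := by
    intro f g hg
    rw [qf_apply, hPT, sub_mul, map_sub, smul_mul_assoc, one_mul, map_smul, hg, smul_zero, sub_zero,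
      II_U, HH_apply, add_mul, add_mul, map_add, map_add, smul_mul_assoc, map_smul, II_U,
      smul_mul_assoc, smul_mul_assoc, one_mul, map_smul, map_smul]
    rfl
  have hff : ∀ f : EE, II (f * f) ≤ ‖Q‖ * qf P f f := fun f => by
    rw [qf_apply, ← smul_eq_mul ‖Q‖, ← map_smul]
    refine II_mono fun x => ?_
    have h1 : P x * Q x = 1 := by
      have := congrArg (fun h : EE => h x) hPQ
      simpa using this
    have h2 : Q x ≤ ‖Q‖ := (le_abs_self _).trans (Q.norm_coe_le_norm x)
    have h3 : 0 ≤ P x * (f x * f x) := mul_nonneg (hP x).le (mul_self_nonneg _)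
    have h4 := mul_le_mul_of_nonneg_right h2 h3
    have h5 : f x * f x = Q x * (P x * (f x * f x)) := by
      rw [← mul_assoc, mul_comm (Q x), h1, one_mul]
    simp only [BoundedContinuousFunction.coe_mul, Pi.mul_apply, BoundedContinuousFunction.coe_smul,
      smul_eq_mul]
    rw [mul_assoc (P x)]
    linarith
  have hq0 : ∀ f, 0 ≤ qf P f f := fun f => wt_int_nonneg P hP f
  obtain ⟨g, M, hM, hg0, hTg⟩ := abs_spec (qf P) (LinearMap.ker II.toLinearMap) T
    (fun f g => by rw [qf_apply, qf_apply, mul_assoc, mul_comm f g, ← mul_assoc]) hq0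
    (‖II‖ * ‖P‖) (fun f => by
      rw [qf_apply]
      refine (le_abs_self _).trans ((II.le_opNorm _).trans ?_)
      rw [mul_assoc ‖II‖]
      refine mul_le_mul_of_nonneg_left ?_ (norm_nonneg _)
      refine (norm_mul_le _ _).trans ?_
      have := mul_le_mul_of_nonneg_right (norm_mul_le P f) (norm_nonneg f)
      nlinarith)
    (‖TP Q R c α‖ ^ 2 * ‖Q‖) (by positivity) (fun f => by
      have h1 : ‖T f‖ ≤ ‖TP Q R c α‖ * ‖VV f‖ := (TP Q R c α).le_opNorm _
      calc ‖T f‖ ^ 2 ≤ (‖TP Q R c α‖ * ‖VV f‖) ^ 2 := by gcongr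
        _ = ‖TP Q R c α‖ ^ 2 * ‖VV f‖ ^ 2 := by ring
        _ ≤ ‖TP Q R c α‖ ^ 2 * (‖Q‖ * qf P f f) := by
            have := (VV_norm f).trans (hff f)
            gcongr
        _ = _ := by ring)
    (fun f => hTX f)
    (fun f hf g hg => by
      rw [hqT f g hg, hqT g f hf, mul_comm (VV f), mul_assoc R, mul_comm (VV (VV f)), ← mul_assoc R,
        mul_comm (ev1 (VV (VV f)))])
    (fun f hf => by
      rw [hqT f f hf]
      have h1 : 0 ≤ II (VV f * VV f) := II_nonneg fun x => mul_self_nonneg _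
      have h2 := mul_nonneg hc.le (wt_int_nonneg R hR (VV (VV f)))
      have h3 := mul_nonneg hα (mul_self_nonneg (ev1 (VV (VV f))))
      linarith)
    (fun u hu => by
      obtain ⟨g, φ, hφ, hg⟩ := VV_cpt ‖Q‖ u (fun n => (hff _).trans
        (mul_le_of_le_one_right (norm_nonneg _) (hu n)))
      exact ⟨TP Q R c α g, φ, hφ, ((TP Q R c α).continuous.tendsto g).comp hg⟩)
    μ⁻¹ (inv_pos.2 hμ) f₀ hf₀ (by
      rw [hqT f₀ f₀ hf₀, qf_apply, hf₀e, ← mul_assoc, inv_mul_cancel₀ hμ.ne', one_mul]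
      have h2 := mul_pos hc (wt_int_pos R hR (VV (VV f₀)) (fun h => hf₀n (VV_inj _ h)))
      have h3 := mul_nonneg hα (mul_self_nonneg (ev1 (VV (VV f₀))))
      linarith)
  have hM0 : 0 < M := (inv_pos.2 hμ).trans hM
  refine ⟨g, M⁻¹, -(M⁻¹ * ((II Q)⁻¹ * II (Q * UU (HH R c α (VV g))))), inv_pos.2 hM0,
    inv_lt_of_inv_lt₀ hμ hM, hg0, ?_, ?_⟩
  · have := hTX g
    rw [hTg, map_smul, smul_eq_mul] at this
    exact (mul_eq_zero.1 this).resolve_left hM0.ne'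
  · have h1 := hPT g
    rw [hTg, mul_smul_comm] at h1
    have h2 : P * g = M⁻¹ • (M • (P * g)) := by rw [smul_smul, inv_mul_cancel₀ hM0.ne', one_smul]
    rw [h2, h1]
    ext x
    simp
    ring

theorem eig_of (p r : ℝ → ℝ) (c α : ℝ)
    (hpc : ContinuousOn p (Icc 0 1)) (hrc : ContinuousOn r (Icc 0 1))
    (f : EE) (lam k : ℝ) (hf : f ≠ 0) (hIf : II f = 0)
    (he : toE p hpc * f = lam • UU (HH (toE r hrc) c α (VV f)) + k • (1:EE)) :
    EigT2 p r c α lam := by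
  set w := VV f with hw
  set y := VV w with hy
  set R := toE r hrc
  set H := HH R c α w with hH
  have h1 : ∀ x ∈ Icc (0:ℝ) 1, exE y x = 0 + exE (VV w) x := fun x hx => by rw [zero_add]
  have h2 : ∀ x ∈ Icc (0:ℝ) 1, exE w x = 0 + exE (VV f) x := fun x hx => by rw [zero_add]
  have d1 : ∀ x ∈ Icc (0:ℝ) 1, Dv (exE y) x = exE w x := fun x hx => step_Dv _ _ _ h1 hx
  have d2 : ∀ x ∈ Icc (0:ℝ) 1, Dv (Dv (exE y)) x = exE f x := fun x hx =>
    step_Dv _ _ 0 (fun x hx => by rw [d1 x hx, zero_add]) hx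
  have h3 : ∀ x ∈ Icc (0:ℝ) 1, p x * Dv (Dv (exE y)) x =
      (lam * II H + k) + exE (VV ((-lam) • H)) x := fun x hx => by
    rw [d2 x hx, exE_of_mem _ hx, exE_of_mem _ hx]
    have := congrArg (fun h : EE => h ⟨x, hx⟩) he
    simp only [UU_apply, map_smul] at this ⊢
    simp [toE_apply] at this ⊢
    rw [this]; ring
  set G : EE := (-lam) • (f - c • (R * y)) with hG
  have h4 : ∀ x ∈ Icc (0:ℝ) 1, exE ((-lam) • H) x =
      (-lam) * (c * II (R * y) + α * ev1 y) + exE (VV G) x := fun x hx => by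
    rw [exE_of_mem _ hx, exE_of_mem _ hx, hH, HH_apply, hG, UU_apply]
    simp only [map_smul, map_sub]
    simp
    ring
  have d3 : ∀ x ∈ Icc (0:ℝ) 1, Dv (fun t => p t * Dv (Dv (exE y)) t) x = exE ((-lam) • H) x :=
    fun x hx => step_Dv _ _ _ h3 hx
  have d4 : ∀ x ∈ Icc (0:ℝ) 1, Dv (Dv (fun t => p t * Dv (Dv (exE y)) t)) x = exE G x :=
    fun x hx => step_Dv _ _ _ (fun x hx => by rw [d3 x hx]; exact h4 x hx) hx
  refine ⟨exE y, ⟨step_two _ w f 0 0 h1 h2, step_two _ _ _ _ _ h3 h4, ?_⟩, ?_, ?_, ?_, ?_, ?_⟩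
  · intro x hx
    rw [d4 x hx, d2 x hx, exE_of_mem _ hx, exE_of_mem _ hx, exE_of_mem _ hx, hG]
    have : R ⟨x, hx⟩ = r x := rfl
    simp [this]
    ring
  · by_contra hcon
    unfold Nontriv at hcon
    push Not at hcon
    apply hf
    apply VV_inj
    apply VV_inj
    ext x
    have := hcon x x.2
    rw [exE_of_mem _ x.2] at this
    simpa using this
  · rw [exE_VV _ zero_mem01]; simp [prim]
  · rw [d1 _ zero_mem01, exE_VV _ zero_mem01]; simp [prim]
  · rw [d1 _ one_mem01, exE_VV _ one_mem01]; exact hIf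
  · rw [d3 _ one_mem01, exE_of_mem _ one_mem01, exE_of_mem _ one_mem01, hH, HH_apply, UU_apply]
    have e1 : w (1 : Icc (0:ℝ) 1) = 0 := hIf
    have e2 : VV (R * y) (1 : Icc (0:ℝ) 1) = II (R * y) := rfl
    have e3 : ev1 y = y (1 : Icc (0:ℝ) 1) := rfl
    simp [e1, e2, e3, ← hy]
    ring

theorem stmt_12 (p r : ℝ → ℝ) (c alpha : ℝ)
    (hpc : ContinuousOn p (Icc 0 1)) (hrc : ContinuousOn r (Icc 0 1))
    (hp : ∀ x ∈ Icc (0:ℝ) 1, 0 < p x) (hr : ∀ x ∈ Icc (0:ℝ) 1, 0 < r x) :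
    (∀ lam : ℝ, lam < 0 → (EigT1 p r c lam ∨ EigT2 p r c alpha lam) →
      lam ∈ AdmSet p) ∧
    (c > 0 → 0 ≤ alpha → ∀ lam : ℝ, 0 < lam → EigT2 p r c alpha lam →
      (∀ μ : ℝ, 0 < μ → μ < lam → ¬ EigT2 p r c alpha μ) → lam ∈ AdmSet p) := by
  have hmu : ∀ μ, DirichletEig p μ → 0 ≤ μ := by
    intro μ hμ
    obtain ⟨f, h1, h2, h3⟩ := dirichlet_data p hpc μ hμ
    have h4 := wt_int_nonneg (toE p hpc) (fun x => hp x x.2) f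
    have h5 := sq_int_pos _ h2
    rw [h3] at h4
    exact nonneg_of_mul_nonneg_left h4 h5
  refine ⟨fun lam hl _ μ hμ => hl.trans_le (hmu μ hμ), ?_⟩
  intro hc hα lam hl _ hmin μ hμ
  by_contra hcon
  push Not at hcon
  obtain ⟨f, h1, h2, h3⟩ := dirichlet_data p hpc μ hμ
  have hf : f ≠ 0 := by rintro rfl; exact h2 (map_zero _)
  have h4 := wt_int_pos (toE p hpc) (fun x => hp x x.2) f hf
  have h5 := sq_int_pos _ h2
  rw [h3] at h4
  have hμ0 : 0 < μ := pos_of_mul_pos_left h4 h5.le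
  have hqc : ContinuousOn (fun x => (p x)⁻¹) (Icc 0 1) := hpc.inv₀ fun x hx => (hp x hx).ne'
  obtain ⟨g, ν, k, hν0, hνμ, hg, hIg, he⟩ := exists_eig (toE p hpc) (toE _ hqc) (toE r hrc)
    (by
      ext x
      simp [toE_apply, (hp x x.2).ne'])
    (fun x => hp x x.2) (fun x => inv_pos.2 (hp x x.2)) (fun x => hr x x.2) c alpha hc hα μ hμ0
    f h1 h2 h3
  exact hmin ν hν0 (hνμ.trans_le hcon) (eig_of p r c alpha hpc hrc g ν k hg hIg he)
end
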